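/- Let (R, m, k) be a commutative noetherian local ring that is a singular hypersurface (i.e., edim R − depth R ≤ 1 and R is not regular) and let t = depth R. Then Ω^t(k) is isomorphic to Ω^{t+2}(k). -/

import Mathlib

universe u

/-- A minimal free resolution of the module `M` over `R`, where minimality is
measured with respect to the ideal `𝔪` (the maximal ideal in applications). -/
structure MinFreeRes (R : Type u) [CommRing R] (𝔪 : Ideal R)
    (M : Type u) [AddCommGroup M] [Module R M] : Type u where
  b : ℕ → ℕ
  aug : (Fin (b 0) → R) →ₗ[R] M
  d : ∀ n : ℕ, (Fin (b (n + 1)) → R) →ₗ[R] (Fin (b n) → R)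
  aug_surj : Function.Surjective aug
  exact_aug : LinearMap.range (d 0) = LinearMap.ker aug
  exact : ∀ n, LinearMap.range (d (n + 1)) = LinearMap.ker (d n)
  minimal : ∀ n, LinearMap.range (d n) ≤ 𝔪 • (⊤ : Submodule R (Fin (b n) → R))

namespace MinFreeRes

variable {R : Type u} [CommRing R] {𝔪 : Ideal R}
  {M : Type u} [AddCommGroup M] [Module R M]

/-- The `n`-th syzygy of `M` given by the minimal free resolution `F`:
`Syz 0 = M` and `Syz (n+1) = image of d n = ker of the previous map`. -/
def Syz (F : MinFreeRes R 𝔪 M) : ℕ → Type u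
  | 0 => M
  | n + 1 => ↥(LinearMap.range (F.d n))

instance (F : MinFreeRes R 𝔪 M) : ∀ n, AddCommGroup (F.Syz n)
  | 0 => inferInstanceAs (AddCommGroup M)
  | n + 1 => inferInstanceAs (AddCommGroup ↥(LinearMap.range (F.d n)))

instance (F : MinFreeRes R 𝔪 M) : ∀ n, Module R (F.Syz n)
  | 0 => inferInstanceAs (Module R M)
  | n + 1 => inferInstanceAs (Module R ↥(LinearMap.range (F.d n)))

/-- The Auslander transpose of `M` computed from the minimal free resolution `F`:
the cokernel of the `R`-dual of the first differential. -/
def Tr (F : MinFreeRes R 𝔪 M) : Type u :=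
  (Module.Dual R (Fin (F.b 1) → R)) ⧸ LinearMap.range ((F.d 0).dualMap)

instance (F : MinFreeRes R 𝔪 M) : AddCommGroup F.Tr :=
  inferInstanceAs (AddCommGroup
    ((Module.Dual R (Fin (F.b 1) → R)) ⧸ LinearMap.range ((F.d 0).dualMap)))

instance (F : MinFreeRes R 𝔪 M) : Module R F.Tr :=
  inferInstanceAs (Module R
    ((Module.Dual R (Fin (F.b 1) → R)) ⧸ LinearMap.range ((F.d 0).dualMap)))

/-- `Ext¹_R(M, N)` computed from the minimal free resolution `F` of `M`:
the homology of `Hom(F₀,N) → Hom(F₁,N) → Hom(F₂,N)` in the middle spot. -/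
def Ext1 (F : MinFreeRes R 𝔪 M) (N : Type u) [AddCommGroup N] [Module R N] : Type u :=
  ↥(LinearMap.ker (LinearMap.lcomp R N (F.d 1))) ⧸
    (LinearMap.range (LinearMap.lcomp R N (F.d 0))).comap
      (LinearMap.ker (LinearMap.lcomp R N (F.d 1))).subtype

instance (F : MinFreeRes R 𝔪 M) (N : Type u) [AddCommGroup N] [Module R N] :
    AddCommGroup (F.Ext1 N) :=
  inferInstanceAs (AddCommGroup
    (↥(LinearMap.ker (LinearMap.lcomp R N (F.d 1))) ⧸
      (LinearMap.range (LinearMap.lcomp R N (F.d 0))).comap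
        (LinearMap.ker (LinearMap.lcomp R N (F.d 1))).subtype))

instance (F : MinFreeRes R 𝔪 M) (N : Type u) [AddCommGroup N] [Module R N] :
    Module R (F.Ext1 N) :=
  inferInstanceAs (Module R
    (↥(LinearMap.ker (LinearMap.lcomp R N (F.d 1))) ⧸
      (LinearMap.range (LinearMap.lcomp R N (F.d 0))).comap
        (LinearMap.ker (LinearMap.lcomp R N (F.d 1))).subtype))

end MinFreeRes

/-- `S` is (isomorphic to) a direct summand of `M` as an `R`-module. -/
def IsDirectSummand (R : Type u) [CommRing R] (S M : Type u)
    [AddCommGroup S] [Module R S] [AddCommGroup M] [Module R M] : Prop :=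
  ∃ (i : S →ₗ[R] M) (p : M →ₗ[R] S), p ∘ₗ i = LinearMap.id

/-- `S` belongs to `add X`: it is a direct summand of a finite direct sum of copies of `X`. -/
def InAddClosure (R : Type u) [CommRing R] (S X : Type u)
    [AddCommGroup S] [Module R S] [AddCommGroup X] [Module R X] : Prop :=
  ∃ r : ℕ, IsDirectSummand R S (Fin r → X)

/-- There exists a short exact sequence `0 → A → B → C → 0` of `R`-modules. -/
def ExistsSES (R : Type u) [CommRing R] (A B C : Type u)
    [AddCommGroup A] [Module R A] [AddCommGroup B] [Module R B]
    [AddCommGroup C] [Module R C] : Prop :=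
  ∃ (i : A →ₗ[R] B) (p : B →ₗ[R] C),
    Function.Injective i ∧ Function.Surjective p ∧ LinearMap.range i = LinearMap.ker p

/-- The `R`-module `M` has depth (with respect to the ideal `𝔪`) equal to `t`:
there is an `M`-regular sequence of length `t` in `𝔪` and no longer one. -/
def HasDepth (R : Type u) [CommRing R] (𝔪 : Ideal R) (M : Type u)
    [AddCommGroup M] [Module R M] (t : ℕ) : Prop :=
  (∃ rs : List R, rs.length = t ∧ (∀ x ∈ rs, x ∈ 𝔪) ∧ RingTheory.Sequence.IsRegular M rs) ∧
  ∀ rs : List R, (∀ x ∈ rs, x ∈ 𝔪) → RingTheory.Sequence.IsRegular M rs → rs.length ≤ t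

/-- `𝔪` needs at least (and exactly) `e` generators. -/
def HasMinGens (R : Type u) [CommRing R] (𝔪 : Ideal R) (e : ℕ) : Prop :=
  (∃ s : Finset R, s.card = e ∧ Ideal.span (s : Set R) = 𝔪) ∧
  ∀ s : Finset R, Ideal.span (s : Set R) = 𝔪 → e ≤ s.card

/-- `R` is a regular local ring with maximal ideal `𝔪`: `𝔪` is generated by
`dim R` elements. -/
def IsRegularWrt (R : Type u) [CommRing R] (𝔪 : Ideal R) : Prop :=
  ∃ s : Finset R, Ideal.span (s : Set R) = 𝔪 ∧ (s.card : WithBot ℕ∞) = ringKrullDim R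

/-- The local ring `(R, 𝔪)` of dimension `d` has Hilbert–Samuel multiplicity `e`:
the function `n ↦ length (R / 𝔪^(n+1))` eventually agrees with a polynomial of
degree `d` whose leading coefficient is `e / d!`. -/
def HasHSMultiplicity (R : Type u) [CommRing R] (𝔪 : Ideal R) (d e : ℕ) : Prop :=
  ∃ p : Polynomial ℚ, p.natDegree = d ∧ p.leadingCoeff * (d.factorial : ℚ) = e ∧
    ∀ᶠ n : ℕ in Filter.atTop, ∃ l : ℕ,
      Order.krullDim (Submodule R (R ⧸ 𝔪 ^ (n + 1))) = l ∧ (l : ℚ) = p.eval (n : ℚ)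

section

open CategoryTheory IsLocalRing Abelian

section Comparison

variable {R : Type u} [CommRing R]

theorem exists_factor_of_range_le {P X Y : Type u} [AddCommGroup P] [Module R P]
    [AddCommGroup X] [Module R X] [AddCommGroup Y] [Module R Y] [Module.Projective R P]
    (f : X →ₗ[R] Y) (g : P →ₗ[R] Y) (h : LinearMap.range g ≤ LinearMap.range f) :
    ∃ l : P →ₗ[R] X, f ∘ₗ l = g := by
  obtain ⟨l, hl⟩ := Module.projective_lifting_property f.rangeRestrict
    (g.codRestrict (LinearMap.range f) fun c => h ⟨c, rfl⟩) f.surjective_rangeRestrict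
  exact ⟨l, LinearMap.ext fun c => congrArg Subtype.val (LinearMap.congr_fun hl c)⟩

/-- A second syzygy `Z → P₁ → P₀ → M`, viewed as a chain of linear maps. -/
structure SecondSyzygy (R : Type u) [CommRing R] (Z P₁ P₀ M : Type u)
    [AddCommGroup Z] [Module R Z] [AddCommGroup P₁] [Module R P₁]
    [AddCommGroup P₀] [Module R P₀] [AddCommGroup M] [Module R M] where
  ι : Z →ₗ[R] P₁
  d : P₁ →ₗ[R] P₀
  π : P₀ →ₗ[R] M
  inj : Function.Injective ι
  surj : Function.Surjective π
  range_ι : LinearMap.range ι = LinearMap.ker d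
  range_d : LinearMap.range d = LinearMap.ker π

namespace SecondSyzygy

variable {Z P₁ P₀ M Z' Q₁ Q₀ : Type u}
  [AddCommGroup Z] [Module R Z] [AddCommGroup P₁] [Module R P₁]
  [AddCommGroup P₀] [Module R P₀] [AddCommGroup M] [Module R M]
  [AddCommGroup Z'] [Module R Z'] [AddCommGroup Q₁] [Module R Q₁]
  [AddCommGroup Q₀] [Module R Q₀]

/-- `φ` is the map on second syzygies induced by a chain map over the identity of `M`. -/
def Induces (S : SecondSyzygy R Z P₁ P₀ M) (T : SecondSyzygy R Z' Q₁ Q₀ M)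
    (φ : Z →ₗ[R] Z') : Prop :=
  ∃ (φ₁ : P₁ →ₗ[R] Q₁) (φ₀ : P₀ →ₗ[R] Q₀),
    T.ι ∘ₗ φ = φ₁ ∘ₗ S.ι ∧ T.d ∘ₗ φ₁ = φ₀ ∘ₗ S.d ∧ T.π ∘ₗ φ₀ = S.π

theorem exists_induces [Module.Projective R P₁] [Module.Projective R P₀]
    (S : SecondSyzygy R Z P₁ P₀ M) (T : SecondSyzygy R Z' Q₁ Q₀ M) :
    ∃ φ, Induces S T φ := by
  obtain ⟨φ₀, h₀⟩ := Module.projective_lifting_property T.π S.π T.surj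
  obtain ⟨φ₁, h₁⟩ := exists_factor_of_range_le T.d (φ₀ ∘ₗ S.d) (by
    rw [T.range_d]
    rintro _ ⟨x, rfl⟩
    have hx : S.d x ∈ LinearMap.ker S.π := S.range_d ▸ ⟨x, rfl⟩
    exact (LinearMap.congr_fun h₀ (S.d x)).trans hx)
  have key : ∀ z, φ₁ (S.ι z) ∈ LinearMap.range T.ι := fun z => by
    have hz : S.ι z ∈ LinearMap.ker S.d := S.range_ι ▸ ⟨z, rfl⟩
    rw [T.range_ι, LinearMap.mem_ker]
    refine (LinearMap.congr_fun h₁ (S.ι z)).trans ?_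
    rw [LinearMap.comp_apply, LinearMap.mem_ker.mp hz, map_zero]
  let e := LinearEquiv.ofInjective T.ι T.inj
  refine ⟨e.symm.toLinearMap ∘ₗ (φ₁ ∘ₗ S.ι).codRestrict _ key, φ₁, φ₀, ?_, h₁, h₀⟩
  ext z
  exact congrArg Subtype.val (e.apply_symm_apply ⟨φ₁ (S.ι z), key z⟩)

theorem Induces.comp {Z'' N₁ N₀ : Type u} [AddCommGroup Z''] [Module R Z''] [AddCommGroup N₁]
    [Module R N₁] [AddCommGroup N₀] [Module R N₀]
    {S : SecondSyzygy R Z P₁ P₀ M} {T : SecondSyzygy R Z' Q₁ Q₀ M}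
    {U : SecondSyzygy R Z'' N₁ N₀ M} {φ : Z →ₗ[R] Z'} {ψ : Z' →ₗ[R] Z''}
    (hφ : Induces S T φ) (hψ : Induces T U ψ) : Induces S U (ψ ∘ₗ φ) := by
  obtain ⟨φ₁, φ₀, h, h₁, h₀⟩ := hφ
  obtain ⟨ψ₁, ψ₀, k, k₁, k₀⟩ := hψ
  refine ⟨ψ₁ ∘ₗ φ₁, ψ₀ ∘ₗ φ₀, ?_, ?_, ?_⟩
  · rw [← LinearMap.comp_assoc, k, LinearMap.comp_assoc, h, LinearMap.comp_assoc]
  · rw [← LinearMap.comp_assoc, k₁, LinearMap.comp_assoc, h₁, LinearMap.comp_assoc]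
  · rw [← LinearMap.comp_assoc, k₀, h₀]

theorem Induces.bijective [IsLocalRing R] [Module.Projective R P₁] [Module.Projective R P₀]
    [IsNoetherian R Z]
    {S : SecondSyzygy R Z P₁ P₀ M} {θ : Z →ₗ[R] Z} (hθ : Induces S S θ)
    (hmin : LinearMap.range S.ι ≤ maximalIdeal R • (⊤ : Submodule R P₁)) :
    Function.Bijective θ := by
  obtain ⟨θ₁, θ₀, h, h₁, h₀⟩ := hθ
  obtain ⟨s, hs⟩ := exists_factor_of_range_le S.d (θ₀ - LinearMap.id) (by
    rw [S.range_d]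
    rintro _ ⟨x, rfl⟩
    have : S.π (θ₀ x) = S.π x := LinearMap.congr_fun h₀ x
    simp [this])
  obtain ⟨g, hg⟩ := exists_factor_of_range_le S.ι (θ₁ - LinearMap.id - s ∘ₗ S.d) (by
    rw [S.range_ι]
    rintro _ ⟨x, rfl⟩
    have h1 : S.d (θ₁ x) = θ₀ (S.d x) := LinearMap.congr_fun h₁ x
    have h2 : S.d (s (S.d x)) = θ₀ (S.d x) - S.d x := LinearMap.congr_fun hs (S.d x)
    simp [h1, h2])
  have key : ∀ z, θ z = z + g (S.ι z) := fun z => S.inj <| by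
    have hz : S.ι z ∈ LinearMap.ker S.d := S.range_ι ▸ ⟨z, rfl⟩
    have h1 := LinearMap.congr_fun hg (S.ι z)
    have h2 := LinearMap.congr_fun h z
    simp only [LinearMap.mem_ker, LinearMap.comp_apply, LinearMap.sub_apply,
      LinearMap.id_apply] at *
    simp [h1, h2, hz]
  have hgm : ∀ z, g (S.ι z) ∈ maximalIdeal R • (⊤ : Submodule R Z) := fun z =>
    (Submodule.map_le_iff_le_comap.mp ((Submodule.map_smul'' _ _ g).le.trans
      (Submodule.smul_mono le_rfl le_top))) (hmin ⟨z, rfl⟩)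
  refine IsNoetherian.bijective_of_surjective_endomorphism θ (LinearMap.range_eq_top.mp ?_)
  refine top_le_iff.mp (Submodule.le_of_le_smul_of_le_jacobson_bot
    (I := maximalIdeal R) (IsNoetherian.noetherian _) (maximalIdeal_le_jacobson _) ?_)
  intro z _
  rw [show z = θ z - g (S.ι z) by rw [key]; abel]
  exact sub_mem (Submodule.mem_sup_left ⟨z, rfl⟩) (Submodule.mem_sup_right (hgm z))

theorem nonempty_linearEquiv [IsLocalRing R] [Module.Projective R P₁] [Module.Projective R P₀]
    [Module.Projective R Q₁] [Module.Projective R Q₀] [IsNoetherian R Z] [IsNoetherian R Z']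
    (S : SecondSyzygy R Z P₁ P₀ M) (T : SecondSyzygy R Z' Q₁ Q₀ M)
    (hS : LinearMap.range S.ι ≤ maximalIdeal R • (⊤ : Submodule R P₁))
    (hT : LinearMap.range T.ι ≤ maximalIdeal R • (⊤ : Submodule R Q₁)) :
    Nonempty (Z ≃ₗ[R] Z') := by
  obtain ⟨φ, hφ⟩ := S.exists_induces T
  obtain ⟨ψ, hψ⟩ := T.exists_induces S
  have h1 := (hφ.comp hψ).bijective hS
  have h2 := (hψ.comp hφ).bijective hT
  exact ⟨LinearEquiv.ofBijective φ ⟨.of_comp h1.1, .of_comp h2.2⟩⟩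

end SecondSyzygy

end Comparison

section Horseshoe

variable {R : Type u} [CommRing R]

theorem ExistsSES.shortExact {A B C : Type u} [AddCommGroup A] [Module R A] [AddCommGroup B]
    [Module R B] [AddCommGroup C] [Module R C] {i : A →ₗ[R] B} {p : B →ₗ[R] C}
    (hi : Function.Injective i) (hp : Function.Surjective p)
    (h : LinearMap.range i = LinearMap.ker p) :
    (ShortComplex.mk (ModuleCat.ofHom i) (ModuleCat.ofHom p)
      (by ext x; exact (h ▸ ⟨x, rfl⟩ : i x ∈ LinearMap.ker p))).ShortExact where
  exact := by
    rw [ShortComplex.moduleCat_exact_iff_range_eq_ker]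
    exact h
  mono_f := (ModuleCat.mono_iff_injective _).mpr hi
  epi_g := (ModuleCat.epi_iff_surjective _).mpr hp

theorem ExistsSES.horseshoe [IsNoetherianRing R] {A B C P Q A' C' : Type u}
    [AddCommGroup A] [Module R A] [AddCommGroup B] [Module R B]
    [AddCommGroup C] [Module R C] [AddCommGroup P] [Module R P]
    [AddCommGroup Q] [Module R Q] [AddCommGroup A'] [Module R A']
    [AddCommGroup C'] [Module R C'] [Module.Projective R P] [Module.Projective R Q]
    [Module.Finite R P] [Module.Finite R Q] {n : ℕ}
    [hB : HasProjectiveDimensionLT (ModuleCat.of R B) (n + 2)]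
    (h : ExistsSES R A B C) (hA : ExistsSES R A' P A) (hC : ExistsSES R C' Q C) :
    ∃ B' : ModuleCat.{u} R, Module.Finite R B' ∧ HasProjectiveDimensionLT B' (n + 1) ∧
      ExistsSES R A' B' C' := by
  obtain ⟨i, p, hi, hp, hip⟩ := h
  obtain ⟨a, f, ha, hf, haf⟩ := hA
  obtain ⟨c, q, hc, hq, hcq⟩ := hC
  obtain ⟨l, hl⟩ := Module.projective_lifting_property p q hp
  have hl' : ∀ x, p (l x) = q x := LinearMap.congr_fun hl
  have hpi : ∀ x, p (i x) = 0 := fun x => (hip ▸ ⟨x, rfl⟩ : i x ∈ LinearMap.ker p)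
  have hfa : ∀ x, f (a x) = 0 := fun x => (haf ▸ ⟨x, rfl⟩ : a x ∈ LinearMap.ker f)
  have hqc : ∀ x, q (c x) = 0 := fun x => (hcq ▸ ⟨x, rfl⟩ : c x ∈ LinearMap.ker q)
  let H : P × Q →ₗ[R] B := (i ∘ₗ f).coprod l
  have hH : ∀ x, H x = i (f x.1) + l x.2 := fun x => rfl
  have hHs : Function.Surjective H := fun b => by
    obtain ⟨y, hy⟩ := hq (p b)
    obtain ⟨z, hz⟩ : b - l y ∈ LinearMap.range i := by
      rw [hip]; simp [hl', hy]
    obtain ⟨x, rfl⟩ := hf z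
    exact ⟨(x, y), by simp [hH, hz]⟩
  have hse := ExistsSES.shortExact (i := (LinearMap.ker H).subtype) (p := H)
    (Subtype.val_injective) hHs (by simp)
  have hqH : ∀ x : LinearMap.ker H, x.1.2 ∈ LinearMap.range c := fun x => by
    have h1 : p (H x.1) = 0 := by rw [x.2]; simp
    rw [hcq]
    simpa [hH, hpi, hl'] using h1
  let e := LinearEquiv.ofInjective c hc
  have he : ∀ y, c (e.symm y) = y := fun y => congrArg Subtype.val (e.apply_symm_apply y)
  refine ⟨ModuleCat.of R (LinearMap.ker H), inferInstanceAs (Module.Finite R (LinearMap.ker H)),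
    ?_, ?_⟩
  · have : Projective (ModuleCat.of R (P × Q)) := 
      (IsProjective.iff_projective (P × Q)).mp inferInstance
    exact (hse.hasProjectiveDimensionLT_X₃_iff n this).mp hB
  · refine ⟨(LinearMap.inl R P Q ∘ₗ a).codRestrict _ fun x => by simp [hH, hfa],
      e.symm.toLinearMap ∘ₗ (LinearMap.snd R P Q ∘ₗ (LinearMap.ker H).subtype).codRestrict _ hqH,
      ?_, ?_, ?_⟩
    · intro x y hxy
      exact ha (congrArg (fun z => z.1.1) hxy)
    · intro y
      obtain ⟨z, hz⟩ : l (c y) ∈ LinearMap.range i := by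
        rw [hip]; simp [hl', hqc]
      obtain ⟨x, rfl⟩ := hf z
      refine ⟨⟨(-x, c y), by simp [hH, hz]⟩, hc ?_⟩
      exact he _
    · ext x
      constructor
      · rintro ⟨y, rfl⟩
        refine hc ?_
        exact (he _).trans (map_zero c).symm
      · intro hx
        have h2 : x.1.2 = 0 := by
          have := congrArg c (LinearMap.mem_ker.mp hx)
          rw [map_zero] at this
          exact (he _).symm.trans this
        have h1 : f x.1.1 = 0 := hi <| by
          have := x.2
          rw [LinearMap.mem_ker, hH, h2] at this
          simpa using this
        obtain ⟨y, hy⟩ : x.1.1 ∈ LinearMap.range a := haf ▸ h1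
        exact ⟨y, Subtype.ext (Prod.ext hy h2.symm)⟩

end Horseshoe

section Chain

variable {R : Type u} [CommRing R] [IsLocalRing R]

/-- `I` is generated by an `R`-regular sequence of length `n` in the maximal ideal whose
members are linearly independent modulo `𝔪²`. -/
inductive IsMinimalRegularIdeal : Ideal R → ℕ → Prop
  | bot : IsMinimalRegularIdeal ⊥ 0
  | step {I : Ideal R} {n : ℕ} {x : R} (hI : IsMinimalRegularIdeal I n)
      (hx : x ∈ maximalIdeal R) (hreg : IsSMulRegular (R ⧸ I) x)
      (hind : x ∉ I ⊔ maximalIdeal R ^ 2) : IsMinimalRegularIdeal (I ⊔ Ideal.span {x}) (n + 1)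

/-- The complex `R ⧸ I → R ⧸ I → R ⧸ (I + (x))` whose first map is multiplication by `x`. -/
def Ideal.quotientSMulShortComplex {R : Type u} [CommRing R] (I : Ideal R) (x : R) :
    ShortComplex (ModuleCat.{u} R) :=
  ShortComplex.mk (X₁ := ModuleCat.of R (R ⧸ I)) (X₂ := ModuleCat.of R (R ⧸ I))
    (X₃ := ModuleCat.of R (R ⧸ (I ⊔ Ideal.span {x})))
    (ModuleCat.ofHom (LinearMap.lsmul R (R ⧸ I) x))
    (ModuleCat.ofHom (Submodule.factor le_sup_left)) (by
      ext1
      refine LinearMap.ext fun y => ?_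
      obtain ⟨r, rfl⟩ := Submodule.Quotient.mk_surjective I y
      exact (Submodule.Quotient.mk_eq_zero _).mpr (Submodule.mem_sup_right
        (Ideal.mem_span_singleton'.mpr ⟨r, mul_comm r x⟩)))

theorem Ideal.shortExact_quotientSMulShortComplex {R : Type u} [CommRing R] {I : Ideal R} {x : R}
    (hreg : IsSMulRegular (R ⧸ I) x) : (I.quotientSMulShortComplex x).ShortExact := by
  refine ExistsSES.shortExact (i := LinearMap.lsmul R (R ⧸ I) x) hreg
    (Submodule.factor_surjective le_sup_left) ?_
  ext y
  obtain ⟨r, rfl⟩ := Submodule.Quotient.mk_surjective I y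
  have h : (Submodule.Quotient.mk r : R ⧸ I) ∈ LinearMap.ker
      (Submodule.factor (le_sup_left : I ≤ I ⊔ Ideal.span {x})) ↔ r ∈ I ⊔ Ideal.span {x} :=
    Submodule.Quotient.mk_eq_zero _
  rw [h]
  constructor
  · rintro ⟨z, hz⟩
    obtain ⟨s, rfl⟩ := Submodule.Quotient.mk_surjective I z
    have hz' : (Submodule.Quotient.mk (x * s) : R ⧸ I) = Submodule.Quotient.mk r := hz
    rw [eq_comm, Submodule.Quotient.eq] at hz'
    rw [← sub_add_cancel r (x * s)]
    exact add_mem (Submodule.mem_sup_left hz')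
      (Submodule.mem_sup_right (Ideal.mem_span_singleton'.mpr ⟨s, mul_comm s x⟩))
  · intro hr
    obtain ⟨j, hj, z, hz, rfl⟩ := Submodule.mem_sup.mp hr
    obtain ⟨s, rfl⟩ := Ideal.mem_span_singleton'.mp hz
    refine ⟨Submodule.Quotient.mk s, ?_⟩
    change (Submodule.Quotient.mk (x * s) : R ⧸ I) = Submodule.Quotient.mk (j + s * x)
    rw [eq_comm, Submodule.Quotient.eq, mul_comm x s, add_sub_cancel_right]
    exact hj

namespace IsMinimalRegularIdeal

theorem le_maximalIdeal {I : Ideal R} {n : ℕ} (h : IsMinimalRegularIdeal I n) :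
    I ≤ maximalIdeal R := by
  induction h with
  | bot => exact bot_le
  | step _ hx _ _ ih => exact sup_le ih ((Ideal.span_singleton_le_iff_mem _).mpr hx)

theorem exists_list {I : Ideal R} {n : ℕ} (h : IsMinimalRegularIdeal I n) :
    ∃ rs : List R, rs.length = n ∧ (∀ x ∈ rs, x ∈ maximalIdeal R) ∧ Ideal.ofList rs = I ∧
      RingTheory.Sequence.IsWeaklyRegular R rs := by
  induction h with
  | bot => exact ⟨[], by simp⟩
  | @step I n x _ hx hreg _ ih =>
    obtain ⟨rs, hl, hm, rfl, hw⟩ := ih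
    refine ⟨rs ++ [x], by simp [hl], ?_, by simp, ?_⟩
    · simpa [or_imp, forall_and] using ⟨hm, hx⟩
    · rw [RingTheory.Sequence.isWeaklyRegular_append_iff,
        RingTheory.Sequence.isWeaklyRegular_singleton_iff]
      refine ⟨hw, ?_⟩
      have e : (Ideal.ofList rs • ⊤ : Ideal R) = Ideal.ofList rs := by simp
      rw [e]
      exact hreg

theorem hasProjectiveDimensionLT {I : Ideal R} {n : ℕ} (h : IsMinimalRegularIdeal I n) :
    HasProjectiveDimensionLT (ModuleCat.of R (R ⧸ I)) (n + 1) := by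
  induction h with
  | bot =>
    have : Module.Projective R (R ⧸ (⊥ : Ideal R)) :=
      .of_equiv (Submodule.quotEquivOfEqBot (⊥ : Ideal R) rfl).symm
    have := (IsProjective.iff_projective (R ⧸ (⊥ : Ideal R))).mp this
    exact inferInstance
  | @step I n x _ _ hreg _ ih =>
    have h2 : HasProjectiveDimensionLT (ModuleCat.of R (R ⧸ I)) (n + 2) :=
      hasProjectiveDimensionLT_of_ge _ (n + 1) _ (by lia)
    exact (Ideal.shortExact_quotientSMulShortComplex hreg).hasProjectiveDimensionLT_X₃ (n + 1)
      ih h2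

end IsMinimalRegularIdeal

theorem IsLocalRing.smul_residueField_eq_zero {x : R} (hx : x ∈ maximalIdeal R)
    (c : ResidueField R) : x • c = 0 := by
  rw [Algebra.smul_def, ResidueField.algebraMap_eq, (residue_eq_zero_iff x).mpr hx, zero_mul]

theorem Ext.comp_smul_eq_zero {A : ModuleCat.{u} R} {x : R} (hx : x ∈ maximalIdeal R) {i : ℕ}
    (c : Ext (ModuleCat.of R (ResidueField R)) A i) :
    c.comp (Ext.mk₀ (x • 𝟙 A)) (add_zero i) = 0 := by
  have h : x • 𝟙 (ModuleCat.of R (ResidueField R)) = 0 :=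
    ModuleCat.hom_ext (LinearMap.ext (smul_residueField_eq_zero hx))
  rw [Ext.mk₀_smul, Ext.comp_smul, Ext.comp_mk₀_id, ← Ext.mk₀_id_comp c, ← Ext.smul_comp,
    ← Ext.mk₀_smul, h, Ext.mk₀_zero, Ext.zero_comp]

/-- A hyperplane of `𝔪 / 𝔪²` containing the image of `I` and avoiding `x`. -/
theorem exists_complement_of_notMem_sup_sq [IsNoetherianRing R] {I : Ideal R} {x : R}
    (hx : x ∈ maximalIdeal R) (hI : I ≤ maximalIdeal R) (hind : x ∉ I ⊔ maximalIdeal R ^ 2) :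
    ∃ J : Ideal R, I ⊔ maximalIdeal R ^ 2 ≤ J ∧ J ≤ maximalIdeal R ∧ x ∉ J ∧
      maximalIdeal R ≤ J ⊔ Ideal.span {x} := by
  obtain ⟨J, ⟨h1, h2, h3⟩, hmax⟩ := set_has_maximal_iff_noetherian.mpr
    (inferInstanceAs (IsNoetherian R R))
    {J : Ideal R | I ⊔ maximalIdeal R ^ 2 ≤ J ∧ J ≤ maximalIdeal R ∧ x ∉ J}
    ⟨_, le_rfl, sup_le hI (Ideal.pow_le_self two_ne_zero), hind⟩
  refine ⟨J, h1, h2, h3, fun y hy => ?_⟩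
  by_contra hyJ
  have hyJ' : y ∉ J := fun h => hyJ (Submodule.mem_sup_left h)
  have hxy : x ∈ J ⊔ Ideal.span {y} := by
    by_contra hxy
    refine hmax _ ⟨h1.trans le_sup_left, sup_le h2 ((Ideal.span_singleton_le_iff_mem _).mpr hy),
      hxy⟩ (lt_of_le_of_ne le_sup_left fun h => hyJ' (h ▸ ?_))
    exact Submodule.mem_sup_right (Ideal.mem_span_singleton_self y)
  obtain ⟨j, hj, z, hz, hjz⟩ := Submodule.mem_sup.mp hxy
  obtain ⟨r, rfl⟩ := Ideal.mem_span_singleton'.mp hz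
  by_cases hr : r ∈ maximalIdeal R
  · refine h3 (hjz ▸ J.add_mem hj (h1 (Submodule.mem_sup_right ?_)))
    rw [pow_two]
    exact Ideal.mul_mem_mul hr hy
  · obtain ⟨u, rfl⟩ := notMem_maximalIdeal.mp hr
    refine hyJ ?_
    have : y = ↑u⁻¹ * (x - j) := by rw [← hjz]; simp
    rw [this]
    exact Ideal.mul_mem_left _ _ (sub_mem
      (Submodule.mem_sup_right (Ideal.mem_span_singleton_self x)) (Submodule.mem_sup_left hj))

/-- Every composite of a class in `Extⁱ(X, A)` with a map `A → k` vanishes. -/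
def ExtVanishesOnResidueField (X A : ModuleCat.{u} R) (i : ℕ) : Prop :=
  ∀ (c : Ext X A i) (g : A ⟶ ModuleCat.of R (ResidueField R)),
    c.comp (Ext.mk₀ g) (add_zero i) = 0

theorem ExtVanishesOnResidueField.of_sup_span [IsNoetherianRing R] {I : Ideal R} {x : R}
    (hx : x ∈ maximalIdeal R) (hI : I ≤ maximalIdeal R) (hreg : IsSMulRegular (R ⧸ I) x)
    (hind : x ∉ I ⊔ maximalIdeal R ^ 2) {i : ℕ}
    (h : ExtVanishesOnResidueField (ModuleCat.of R (ResidueField R))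
      (ModuleCat.of R (R ⧸ (I ⊔ Ideal.span {x}))) i) :
    ExtVanishesOnResidueField (ModuleCat.of R (ResidueField R))
      (ModuleCat.of R (R ⧸ I)) (i + 1) := by
  intro c g
  obtain ⟨J, hIJ, hJ, hxJ, hJx⟩ := exists_complement_of_notMem_sup_sq hx hI hind
  obtain ⟨c', rfl⟩ := Ext.covariant_sequence_exact₁ _
    (Ideal.shortExact_quotientSMulShortComplex hreg) c (Ext.comp_smul_eq_zero hx c) rfl
  have hIJ' : I ≤ J := le_sup_left.trans hIJ
  have hJx' : maximalIdeal R = J ⊔ Ideal.span {x} :=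
    le_antisymm hJx (sup_le hJ ((Ideal.span_singleton_le_iff_mem _).mpr hx))
  let a : ResidueField R →ₗ[R] R ⧸ J := Submodule.liftQ (maximalIdeal R)
    (LinearMap.toSpanSingleton R (R ⧸ J) (Submodule.Quotient.mk x)) (fun y hy => by
      rw [LinearMap.mem_ker, LinearMap.toSpanSingleton_apply, ← Submodule.Quotient.mk_smul,
        Submodule.Quotient.mk_eq_zero]
      refine hIJ (Submodule.mem_sup_right ?_)
      rw [pow_two]
      exact Ideal.mul_mem_mul hy hx)
  have ha : ∀ r : R, a (residue R r) = Submodule.Quotient.mk (r * x) := fun r => rfl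
  let b : R ⧸ J →ₗ[R] ResidueField R := Submodule.factor hJ
  have hb : ∀ r : R, b (Submodule.Quotient.mk r) = residue R r := fun r => rfl
  have hai : Function.Injective a := (injective_iff_map_eq_zero a).mpr fun y hy => by
    obtain ⟨r, rfl⟩ := residue_surjective y
    rw [ha, Submodule.Quotient.mk_eq_zero] at hy
    by_contra hr
    obtain ⟨u, rfl⟩ := notMem_maximalIdeal.mp (mt (residue_eq_zero_iff r).mpr hr)
    exact hxJ ((Ideal.unit_mul_mem_iff_mem J u.isUnit).mp hy)
  have hab : LinearMap.range a = LinearMap.ker b := by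
    ext y
    obtain ⟨r, rfl⟩ := Submodule.Quotient.mk_surjective J y
    rw [LinearMap.mem_ker, hb, residue_eq_zero_iff, hJx']
    constructor
    · rintro ⟨z, hz⟩
      obtain ⟨s, rfl⟩ := residue_surjective z
      rw [ha, eq_comm, Submodule.Quotient.eq] at hz
      rw [← sub_add_cancel r (s * x)]
      exact add_mem (Submodule.mem_sup_left hz)
        (Submodule.mem_sup_right (Ideal.mem_span_singleton'.mpr ⟨s, rfl⟩))
    · intro hr
      obtain ⟨j, hj, z, hz, hjz⟩ := Submodule.mem_sup.mp hr
      obtain ⟨s, rfl⟩ := Ideal.mem_span_singleton'.mp hz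
      refine ⟨residue R s, ?_⟩
      rw [ha, eq_comm, Submodule.Quotient.eq, ← hjz, add_sub_cancel_right]
      exact hj
  have hT := ExistsSES.shortExact hai (Submodule.factor_surjective hJ) hab
  obtain ⟨r, hr⟩ := residue_surjective (g.hom (Submodule.Quotient.mk 1))
  have hxI : I ⊔ Ideal.span {x} ≤ maximalIdeal R :=
    sup_le hI ((Ideal.span_singleton_le_iff_mem _).mpr hx)
  have hg : ∀ s : R, g.hom (Submodule.Quotient.mk s) = residue R (s * r) := fun s => by
    have hs : (Submodule.Quotient.mk s : R ⧸ I) = s • Submodule.Quotient.mk 1 := by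
      rw [← Submodule.Quotient.mk_smul, smul_eq_mul, mul_one]
    rw [hs, map_smul, ← hr, map_mul, Algebra.smul_def, ResidueField.algebraMap_eq]
  have hz : ModuleCat.ofHom a ≫ ModuleCat.ofHom (Submodule.factor hJ) = 0 := by
    ext1
    exact LinearMap.range_le_ker_iff.mp hab.le
  let φ : I.quotientSMulShortComplex x ⟶ ShortComplex.mk (X₁ := ModuleCat.of R (ResidueField R))
      (X₂ := ModuleCat.of R (R ⧸ J)) (X₃ := ModuleCat.of R (R ⧸ maximalIdeal R))
      (ModuleCat.ofHom a) (ModuleCat.ofHom (Submodule.factor hJ)) hz :=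
    { τ₁ := g
      τ₂ := ModuleCat.ofHom (r • Submodule.factor hIJ')
      τ₃ := ModuleCat.ofHom (r • Submodule.factor hxI)
      comm₁₂ := by
        ext1
        refine LinearMap.ext fun y => ?_
        obtain ⟨s, rfl⟩ := Submodule.Quotient.mk_surjective I y
        refine (congrArg a (hg s)).trans ?_
        rw [ha]
        change _ = (Submodule.Quotient.mk (r * (x * s)) : R ⧸ J)
        ring_nf
      comm₂₃ := by
        ext1
        refine LinearMap.ext fun y => ?_
        obtain ⟨s, rfl⟩ := Submodule.Quotient.mk_surjective I y
        rfl }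
  have key := ShortComplex.ShortExact.extClass_naturality
    (Ideal.shortExact_quotientSMulShortComplex hreg) hT φ
  refine (Ext.comp_assoc c' _ (Ext.mk₀ φ.τ₁) rfl (add_zero 1) rfl).trans ?_
  refine (congrArg (fun z => c'.comp z rfl) key).trans ?_
  refine (Ext.comp_assoc c' (Ext.mk₀ φ.τ₃) _ (add_zero i) (zero_add 1) rfl).symm.trans ?_
  exact (congrArg (fun z => Ext.comp z hT.extClass rfl) (h c' φ.τ₃)).trans (Ext.zero_comp ..)

end Chain

namespace MinFreeRes

variable {R : Type u} [CommRing R] {𝔪 : Ideal R} {M : Type u} [AddCommGroup M] [Module R M]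
  (F : MinFreeRes R 𝔪 M)

/-- The projection of the `n`-th free module onto the `n`-th syzygy. -/
def proj : ∀ n, (Fin (F.b n) → R) →ₗ[R] F.Syz n
  | 0 => F.aug
  | n + 1 => (F.d n).rangeRestrict

/-- The inclusion of the `(n + 1)`-st syzygy in the `n`-th free module. -/
def incl (n : ℕ) : F.Syz (n + 1) →ₗ[R] (Fin (F.b n) → R) := (LinearMap.range (F.d n)).subtype

theorem proj_surjective : ∀ n, Function.Surjective (F.proj n)
  | 0 => F.aug_surj
  | n + 1 => (F.d n).surjective_rangeRestrict

theorem incl_injective (n : ℕ) : Function.Injective (F.incl n) := Subtype.val_injective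

theorem range_incl (n : ℕ) : LinearMap.range (F.incl n) = LinearMap.range (F.d n) :=
  Submodule.range_subtype _

theorem range_d_eq_ker_proj : ∀ n, LinearMap.range (F.d n) = LinearMap.ker (F.proj n)
  | 0 => F.exact_aug
  | n + 1 => (F.exact n).trans (LinearMap.ker_rangeRestrict (F.d n)).symm

theorem range_incl_le (n : ℕ) : LinearMap.range (F.incl n) ≤ 𝔪 • ⊤ :=
  (F.range_incl n).le.trans (F.minimal n)

theorem existsSES (n : ℕ) : ExistsSES R (F.Syz (n + 1)) (Fin (F.b n) → R) (F.Syz n) :=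
  ⟨F.incl n, F.proj n, F.incl_injective n, F.proj_surjective n,
    (F.range_incl n).trans (F.range_d_eq_ker_proj n)⟩

instance [Module.Finite R M] : ∀ n, Module.Finite R (F.Syz n)
  | n => .of_surjective (F.proj n) (F.proj_surjective n)

/-- The resolution exhibits the `(n + 2)`-nd syzygy of `M` as a second syzygy of the `n`-th. -/
def secondSyzygy (n : ℕ) :
    SecondSyzygy R (F.Syz (n + 2)) (Fin (F.b (n + 1)) → R) (Fin (F.b n) → R) (F.Syz n) where
  ι := F.incl (n + 1)
  d := F.d n
  π := F.proj n
  inj := F.incl_injective (n + 1)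
  surj := F.proj_surjective n
  range_ι := (F.range_incl (n + 1)).trans (F.exact n)
  range_d := F.range_d_eq_ker_proj n

end MinFreeRes

section Vanishing

variable {R : Type u} [CommRing R] [IsLocalRing R]

theorem extVanishesOnResidueField_zero {I : Ideal R} (hI : ¬ maximalIdeal R ≤ I) :
    ExtVanishesOnResidueField (ModuleCat.of R (ResidueField R)) (ModuleCat.of R (R ⧸ I)) 0 := by
  intro c g
  obtain ⟨f, rfl⟩ := (Ext.mk₀_bijective _ _).2 c
  rw [Ext.mk₀_comp_mk₀]
  suffices h : f ≫ g = 0 by rw [h, Ext.mk₀_zero]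
  ext1
  refine LinearMap.ext fun y => ?_
  obtain ⟨s, rfl⟩ := residue_surjective y
  obtain ⟨z, hz⟩ := Submodule.Quotient.mk_surjective I (f.hom (residue R s))
  change g.hom (f.hom (residue R s)) = 0
  have hzm : z ∈ maximalIdeal R := by
    by_contra hzm
    obtain ⟨u, rfl⟩ := notMem_maximalIdeal.mp hzm
    refine hI fun y hy => (Ideal.mul_unit_mem_iff_mem I u.isUnit).mp ?_
    rw [← smul_eq_mul, ← Submodule.Quotient.mk_eq_zero, Submodule.Quotient.mk_smul, hz,
      ← map_smul, smul_residueField_eq_zero hy, map_zero]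
  rw [← hz, show (Submodule.Quotient.mk z : R ⧸ I) = z • Submodule.Quotient.mk 1 by
    rw [← Submodule.Quotient.mk_smul, smul_eq_mul, mul_one], map_smul]
  exact smul_residueField_eq_zero hzm _

theorem IsMinimalRegularIdeal.extVanishesOnResidueField [IsNoetherianRing R] {I : Ideal R} {n : ℕ}
    (h : IsMinimalRegularIdeal I n) {i : ℕ}
    (hi : ExtVanishesOnResidueField (ModuleCat.of R (ResidueField R)) (ModuleCat.of R (R ⧸ I)) i) :
    ExtVanishesOnResidueField (ModuleCat.of R (ResidueField R))
      (ModuleCat.of R (R ⧸ (⊥ : Ideal R))) (i + n) := by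
  induction h generalizing i with
  | bot => exact hi
  | @step I n x hI hx hreg hind ih =>
    rw [add_comm n, ← add_assoc]
    exact ih (.of_sup_span hx hI.le_maximalIdeal hreg hind hi)

theorem ExtVanishesOnResidueField.of_shortExact {S : ShortComplex (ModuleCat.{u} R)}
    (hS : S.ShortExact) [Projective S.X₂]
    (hmin : ∀ f : S.X₂ ⟶ ModuleCat.of R (ResidueField R), S.f ≫ f = 0) {A : ModuleCat.{u} R}
    {i : ℕ} (h : ExtVanishesOnResidueField S.X₃ A (i + 1)) :
    ExtVanishesOnResidueField S.X₁ A i := by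
  intro c g
  have h0 := h (hS.extClass.comp c (add_comm 1 i)) g
  rw [Ext.comp_assoc _ _ _ (add_comm 1 i) (add_zero i) (by lia)] at h0
  obtain ⟨x, hx⟩ := Ext.contravariant_sequence_exact₁ hS _ _ (add_comm 1 i) h0
  rw [← hx]
  cases i with
  | zero =>
    obtain ⟨f, rfl⟩ := (Ext.mk₀_bijective _ _).2 x
    rw [Ext.mk₀_comp_mk₀, hmin, Ext.mk₀_zero]
  | succ i => rw [Ext.eq_zero_of_projective x, Ext.comp_zero]

theorem MinFreeRes.extVanishesOnResidueField_syz {M : Type u} [AddCommGroup M] [Module R M]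
    (F : MinFreeRes R (maximalIdeal R) M) {A : ModuleCat.{u} R} (n i : ℕ)
    (h : ExtVanishesOnResidueField (ModuleCat.of R M) A (i + n)) :
    ExtVanishesOnResidueField (ModuleCat.of R (F.Syz n)) A i := by
  induction n generalizing i with
  | zero => exact h
  | succ n ih =>
    have hS := ExistsSES.shortExact (F.incl_injective n) (F.proj_surjective n)
      ((F.range_incl n).trans (F.range_d_eq_ker_proj n))
    have : Projective (ModuleCat.of R (Fin (F.b n) → R)) :=
      (IsProjective.iff_projective _).mp inferInstance
    refine ExtVanishesOnResidueField.of_shortExact hS (fun f => ?_) (ih (i + 1) ?_)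
    · ext1
      refine LinearMap.ext fun y => ?_
      have hy : F.incl n y ∈ maximalIdeal R • (⊤ : Submodule R (Fin (F.b n) → R)) :=
        F.range_incl_le n ⟨y, rfl⟩
      change f.hom (F.incl n y) = 0
      refine Submodule.smul_induction_on (p := fun v => f.hom v = 0) hy (fun r hr v _ => ?_)
        fun v w hv hw => ?_
      · rw [map_smul]
        exact smul_residueField_eq_zero hr _
      · rw [map_add, hv, hw, add_zero]
    · rwa [add_assoc, add_comm 1 n]

theorem ExtVanishesOnResidueField.apply_mem_maximalIdeal {X : Type u} [AddCommGroup X] [Module R X]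
    (h : ExtVanishesOnResidueField (ModuleCat.of R X) (ModuleCat.of R (R ⧸ (⊥ : Ideal R))) 0)
    (f : X →ₗ[R] R) (x : X) : f x ∈ maximalIdeal R := by
  have h0 := h (Ext.mk₀ (ModuleCat.ofHom (Submodule.mkQ ⊥ ∘ₗ f)))
    (ModuleCat.ofHom (Submodule.factor bot_le : R ⧸ (⊥ : Ideal R) →ₗ[R] R ⧸ maximalIdeal R))
  rw [Ext.mk₀_comp_mk₀, Ext.mk₀_eq_zero_iff] at h0
  have h1 : residue R (f x) = 0 := LinearMap.congr_fun (congrArg ModuleCat.Hom.hom h0) x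
  exact (residue_eq_zero_iff _).mp h1

end Vanishing

section Existence

theorem subsingleton_ext_quotient_sup_span {R : Type u} [CommRing R] {X : ModuleCat.{u} R}
    {I : Ideal R} {x : R} (hreg : IsSMulRegular (R ⧸ I) x) {i : ℕ}
    (h : Subsingleton (Ext X (ModuleCat.of R (R ⧸ I)) i))
    (h' : Subsingleton (Ext X (ModuleCat.of R (R ⧸ I)) (i + 1))) :
    Subsingleton (Ext X (ModuleCat.of R (R ⧸ (I ⊔ Ideal.span {x}))) i) := by
  refine subsingleton_of_forall_eq 0 fun c => ?_
  obtain ⟨c', rfl⟩ := Ext.covariant_sequence_exact₃ X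
    (Ideal.shortExact_quotientSMulShortComplex hreg) c rfl (h'.elim _ _)
  exact (congrArg (fun z => Ext.comp z _ (add_zero i)) (h.elim c' 0)).trans (Ext.zero_comp ..)

variable {R : Type u} [CommRing R] [IsLocalRing R]

theorem exists_card_lt_of_notMem_sup_sq {I : Ideal R} {s : Finset R}
    (hs : maximalIdeal R = Ideal.span s ⊔ I) {x : R} (hx : x ∈ maximalIdeal R)
    (hind : x ∉ I ⊔ maximalIdeal R ^ 2) :
    ∃ s' : Finset R, s'.card + 1 = s.card ∧
      maximalIdeal R = Ideal.span s' ⊔ (I ⊔ Ideal.span {x}) := by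
  classical
  have hI : I ≤ maximalIdeal R := hs ▸ le_sup_right
  have hsm : ∀ a ∈ s, a ∈ maximalIdeal R := fun a ha =>
    hs ▸ Submodule.mem_sup_left (Ideal.subset_span ha)
  obtain ⟨v, hv, j, hj, hvj⟩ := Submodule.mem_sup.mp (hs ▸ hx)
  obtain ⟨c, rfl⟩ := Submodule.mem_span_finset'.mp hv
  have hc : ∃ a : s, c a ∉ maximalIdeal R := by
    by_contra! hc
    refine hind (hvj ▸ add_mem (Submodule.mem_sup_right ?_) (Submodule.mem_sup_left hj))
    refine sum_mem fun a _ => ?_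
    rw [pow_two]
    exact Ideal.mul_mem_mul (hc a) (hsm a a.2)
  obtain ⟨⟨a, ha⟩, hc⟩ := hc
  obtain ⟨w, hw⟩ := notMem_maximalIdeal.mp hc
  refine ⟨s.erase a, Finset.card_erase_add_one ha, le_antisymm ?_ ?_⟩
  · set K := Ideal.span (s.erase a : Set R) ⊔ (I ⊔ Ideal.span {x})
    have hK : ∀ b ∈ s, b ≠ a → b ∈ K := fun b hb hba =>
      Submodule.mem_sup_left (Ideal.subset_span (Finset.mem_erase.mpr ⟨hba, hb⟩))
    have hIK : I ≤ K := le_sup_left.trans le_sup_right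
    have hxK : x ∈ K :=
      Submodule.mem_sup_right (Submodule.mem_sup_right (Ideal.mem_span_singleton_self x))
    have haK : a ∈ K := by
      rw [← Finset.add_sum_erase _ _ (Finset.mem_univ (⟨a, ha⟩ : s))] at hvj
      have h : c ⟨a, ha⟩ • a ∈ K := by
        have h2 : ∑ b ∈ Finset.univ.erase (⟨a, ha⟩ : s), c b • (b : R) ∈ K :=
          sum_mem fun b hb => K.smul_mem _ (hK b b.2 fun h =>
            (Finset.mem_erase.mp hb).1 (Subtype.ext h))
        have h3 : c ⟨a, ha⟩ • a = x - j - ∑ b ∈ Finset.univ.erase (⟨a, ha⟩ : s), c b • (b : R) := by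
          rw [← hvj]
          ring
        rw [h3]
        exact sub_mem (sub_mem hxK (hIK hj)) h2
      rw [← hw, smul_eq_mul] at h
      exact (Ideal.unit_mul_mem_iff_mem K w.isUnit).mp h
    rw [hs]
    refine sup_le (Ideal.span_le.mpr fun b hb => ?_) hIK
    by_cases hba : b = a
    · exact hba ▸ haK
    · exact hK b hb hba
  · refine sup_le (Ideal.span_le.mpr fun b hb => hsm b (Finset.mem_of_mem_erase hb)) (sup_le hI ?_)
    exact (Ideal.span_singleton_le_iff_mem _).mpr hx

theorem IsMinimalRegularIdeal.exists_isRegular {I : Ideal R} {n : ℕ}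
    (hI : IsMinimalRegularIdeal I n) :
    ∃ rs : List R, rs.length = n ∧ (∀ x ∈ rs, x ∈ maximalIdeal R) ∧ Ideal.ofList rs = I ∧
      RingTheory.Sequence.IsRegular R rs := by
  obtain ⟨rs, hl, hm, rfl, hw⟩ := hI.exists_list
  refine ⟨rs, hl, hm, rfl, (RingTheory.Sequence.isRegular_iff _ _).mpr ⟨hw, fun h => ?_⟩⟩
  refine (maximalIdeal.isMaximal R).ne_top (top_le_iff.mp ?_)
  rw [h]
  simpa using hI.le_maximalIdeal

theorem IsMinimalRegularIdeal.not_isSMulRegular {t : ℕ} (ht : HasDepth R (maximalIdeal R) R t)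
    {I : Ideal R} (hI : IsMinimalRegularIdeal I t) {x : R} (hx : x ∈ maximalIdeal R) :
    ¬ IsSMulRegular (R ⧸ I) x := by
  intro hreg
  obtain ⟨rs, hl, hm, rfl, hr⟩ := hI.exists_isRegular
  have h := ht.2 (rs ++ [x]) (by simpa [or_imp, forall_and] using ⟨hm, hx⟩) <| by
    rw [RingTheory.Sequence.isRegular_iff, RingTheory.Sequence.isWeaklyRegular_append_iff,
      RingTheory.Sequence.isWeaklyRegular_singleton_iff]
    refine ⟨⟨hr.1, ?_⟩, fun h => ?_⟩
    · have e : (Ideal.ofList rs • ⊤ : Ideal R) = Ideal.ofList rs := by simp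
      rw [e]
      exact hreg
    · refine (maximalIdeal.isMaximal R).ne_top (top_le_iff.mp ?_)
      rw [h]
      simpa using ⟨hI.le_maximalIdeal, hx⟩
  simp [hl] at h

variable [IsNoetherianRing R]

theorem IsLocalRing.subsingleton_ext_residueField_zero_iff {I : Ideal R} :
    Subsingleton (Ext (ModuleCat.of R (ResidueField R)) (ModuleCat.of R (R ⧸ I)) 0) ↔
      ∃ r ∈ maximalIdeal R, IsSMulRegular (R ⧸ I) r := by
  have e : Ext (ModuleCat.of R (ResidueField R)) (ModuleCat.of R (R ⧸ I)) 0 ≃+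
      (ResidueField R →ₗ[R] R ⧸ I) := Ext.addEquiv₀.trans ModuleCat.homAddEquiv
  rw [e.toEquiv.subsingleton_congr, IsSMulRegular.subsingleton_linearMap_iff]
  have h : Module.annihilator R (ResidueField R) = maximalIdeal R := Ideal.annihilator_quotient
  rw [h]

theorem HasDepth.subsingleton_ext {t : ℕ} (ht : HasDepth R (maximalIdeal R) R t) {i : ℕ}
    (hi : i < t) : Subsingleton
      (Ext (ModuleCat.of R (ResidueField R)) (ModuleCat.of R (R ⧸ (⊥ : Ideal R))) i) := by
  obtain ⟨⟨rs, hl, hm, hreg⟩, -⟩ := ht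
  let e : R ≃ₗ[R] (R ⧸ (⊥ : Ideal R)) := (Submodule.quotEquivOfEqBot _ rfl).symm
  have hreg' : RingTheory.Sequence.IsRegular (R ⧸ (⊥ : Ideal R)) rs :=
    (e.isRegular_congr rs).mp hreg
  refine ModuleCat.subsingleton_ext_of_exists_isRegular (maximalIdeal R) _ ?_ _ ?_ rs hm hreg' i
    (hl ▸ hi)
  · have h : Module.annihilator R (ResidueField R) = maximalIdeal R := Ideal.annihilator_quotient
    rw [Module.support_eq_zeroLocus]
    exact (congrArg (fun I : Ideal R => PrimeSpectrum.zeroLocus (I : Set R)) h).le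
  · have : Nontrivial (R ⧸ (⊥ : Ideal R)) := e.symm.nontrivial
    refine lt_top_iff_ne_top.mpr fun h => ?_
    exact top_ne_bot (Submodule.eq_bot_of_le_smul_of_le_jacobson_bot (maximalIdeal R) ⊤
      (Module.Finite.fg_top) h.ge (maximalIdeal_le_jacobson ⊥))

theorem exists_isSMulRegular_notMem_sup_sq {I : Ideal R} (hI : I ≤ maximalIdeal R) {r : R}
    (hr : r ∈ maximalIdeal R) (hreg : IsSMulRegular (R ⧸ I) r) :
    ∃ x ∈ maximalIdeal R, IsSMulRegular (R ⧸ I) x ∧ x ∉ I ⊔ maximalIdeal R ^ 2 := by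
  by_contra! h
  have hsub : (maximalIdeal R : Set R) ⊆ ⋃ P ∈ insert (I ⊔ maximalIdeal R ^ 2)
      (associatedPrimes R (R ⧸ I)), (P : Set R) := by
    intro x hx
    by_cases hxr : IsSMulRegular (R ⧸ I) x
    · exact Set.mem_biUnion (Set.mem_insert _ _) (h x hx hxr)
    · have hxP : x ∈ ⋃ P ∈ associatedPrimes R (R ⧸ I), (P : Set R) := by
        rw [biUnion_associatedPrimes_eq_compl_regular]
        exact hxr
      exact Set.biUnion_subset_biUnion_left (Set.subset_insert _ _) hxP
  obtain ⟨P, hP, hmP⟩ := (Ideal.subset_union_prime_finite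
    ((associatedPrimes.finite R (R ⧸ I)).insert (I ⊔ maximalIdeal R ^ 2)) (f := id)
    (I ⊔ maximalIdeal R ^ 2) (I ⊔ maximalIdeal R ^ 2)
    (fun P hP hne _ => (hP.resolve_left hne).isPrime)).mp hsub
  rcases hP with rfl | hP
  · have hmI : maximalIdeal R ≤ I := by
      refine Submodule.le_of_le_smul_of_le_jacobson_bot (IsNoetherian.noetherian _)
        (maximalIdeal_le_jacobson ⊥) ?_
      rwa [smul_eq_mul, ← pow_two]
    have h1 : (Submodule.Quotient.mk 1 : R ⧸ I) = 0 := hreg (by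
      change r • (Submodule.Quotient.mk 1 : R ⧸ I) = r • 0
      rw [smul_zero, ← Submodule.Quotient.mk_smul, smul_eq_mul, mul_one,
        Submodule.Quotient.mk_eq_zero]
      exact hmI hr)
    rw [Submodule.Quotient.mk_eq_zero] at h1
    exact (Ideal.ne_top_iff_one _).mp (maximalIdeal.isMaximal R).ne_top (hI h1)
  · have hrP : r ∈ ⋃ P ∈ associatedPrimes R (R ⧸ I), (P : Set R) :=
      Set.mem_biUnion hP (hmP hr)
    rw [biUnion_associatedPrimes_eq_compl_regular] at hrP
    exact hrP hreg

theorem exists_isMinimalRegularIdeal {t : ℕ} (ht : HasDepth R (maximalIdeal R) R t)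
    {s : Finset R} (hs : Ideal.span (s : Set R) = maximalIdeal R) {n : ℕ} (hn : n ≤ t) :
    ∃ (I : Ideal R) (s' : Finset R), IsMinimalRegularIdeal I n ∧
      maximalIdeal R = Ideal.span s' ⊔ I ∧ s'.card + n = s.card ∧ ∀ i, i + n < t →
        Subsingleton (Ext (ModuleCat.of R (ResidueField R)) (ModuleCat.of R (R ⧸ I)) i) := by
  induction n with
  | zero => exact ⟨⊥, s, .bot, by rw [hs, sup_bot_eq], rfl, fun i hi => ht.subsingleton_ext hi⟩
  | succ n ih =>
    obtain ⟨I, s', hI, hs', hcard, hext⟩ := ih (by lia)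
    obtain ⟨r, hr, hreg⟩ := subsingleton_ext_residueField_zero_iff.mp (hext 0 (by lia))
    obtain ⟨x, hx, hxreg, hind⟩ := exists_isSMulRegular_notMem_sup_sq hI.le_maximalIdeal hr hreg
    obtain ⟨s'', hcard', hs''⟩ := exists_card_lt_of_notMem_sup_sq hs' hx hind
    exact ⟨_, s'', hI.step hx hxreg hind, hs'', by lia, fun i hi =>
      subsingleton_ext_quotient_sup_span hxreg (hext i (by lia)) (hext (i + 1) (by lia))⟩

theorem IsMinimalRegularIdeal.isRegularWrt {t : ℕ} (hI : IsMinimalRegularIdeal (maximalIdeal R) t) :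
    IsRegularWrt R (maximalIdeal R) := by
  classical
  obtain ⟨rs, hl, hm, hrs, hr⟩ := hI.exists_isRegular
  have h := ringKrullDim_add_length_eq_ringKrullDim_of_isRegular rs hr
  have h0 : ringKrullDim (R ⧸ Ideal.ofList rs) = 0 := by
    rw [hrs]
    exact ringKrullDim_eq_zero_of_field (ResidueField R)
  have hspan : Ideal.span (rs.toFinset : Set R) = maximalIdeal R := by
    rw [← hrs, Ideal.ofList]
    congr 1
    ext
    simp
  refine ⟨rs.toFinset, hspan, le_antisymm ?_ ?_⟩
  · rw [← h, h0, zero_add]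
    exact_mod_cast rs.toFinset_card_le
  · have h1 := ringKrullDim_le_ringKrullDim_quotient_add_card rs.toFinset
      (by rw [IsLocalRing.ringJacobson_eq_maximalIdeal]; exact fun x hx => hm x (by simpa using hx))
    have h2 : ringKrullDim (R ⧸ Ideal.span (rs.toFinset : Set R)) = 0 := by
      rw [hspan]
      exact ringKrullDim_eq_zero_of_field (ResidueField R)
    rwa [h2, zero_add] at h1

end Existence

section Socle

variable {R : Type u} [CommRing R] [IsLocalRing R] {I : Ideal R} {y : R}

theorem exists_sub_pow_mul_mem_of_mul_mem (hm : maximalIdeal R = Ideal.span {y} ⊔ I) {z : R}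
    (hz : y * z ∈ I) {n : ℕ} (hn : y ^ n ∉ I) : ∃ w, z - y ^ n * w ∈ I := by
  induction n with
  | zero => exact ⟨z, by simp⟩
  | succ n ih =>
    obtain ⟨w, hw⟩ := ih fun h => hn (by rw [pow_succ]; exact I.mul_mem_right _ h)
    have hwm : w ∈ maximalIdeal R := by
      by_contra hwm
      obtain ⟨v, rfl⟩ := notMem_maximalIdeal.mp hwm
      refine hn ((Ideal.mul_unit_mem_iff_mem I v.isUnit).mp ?_)
      have h : y ^ (n + 1) * v = y * z - y * (z - y ^ n * v) := by ring
      rw [h]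
      exact sub_mem hz (I.mul_mem_left _ hw)
    rw [hm] at hwm
    obtain ⟨a, ha, i, hi, rfl⟩ := Submodule.mem_sup.mp hwm
    obtain ⟨s, rfl⟩ := Ideal.mem_span_singleton'.mp ha
    refine ⟨s, ?_⟩
    have h : z - y ^ (n + 1) * s = (z - y ^ n * (s * y + i)) + y ^ n * i := by ring
    rw [h]
    exact add_mem hw (I.mul_mem_left _ hi)

theorem exists_pow_mem_of_not_isSMulRegular [IsNoetherianRing R]
    (hm : maximalIdeal R = Ideal.span {y} ⊔ I) (hy : ¬ IsSMulRegular (R ⧸ I) y) :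
    ∃ n, y ^ n ∈ I := by
  by_contra! h
  refine hy ((isSMulRegular_iff_right_eq_zero_of_smul).mpr fun z hz => ?_)
  obtain ⟨z, rfl⟩ := Submodule.Quotient.mk_surjective I z
  rw [← Submodule.Quotient.mk_smul, Submodule.Quotient.mk_eq_zero, smul_eq_mul] at hz
  have hym : y ∈ maximalIdeal R := hm ▸ Submodule.mem_sup_left (Ideal.mem_span_singleton_self y)
  have hinf := Ideal.iInf_pow_smul_eq_bot_of_isLocalRing (M := R ⧸ I) (maximalIdeal R)
    (maximalIdeal.isMaximal R).ne_top
  rw [← Submodule.mem_bot R, ← hinf, Submodule.mem_iInf]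
  intro n
  obtain ⟨w, hw⟩ := exists_sub_pow_mul_mem_of_mul_mem hm hz (h n)
  rw [(Submodule.Quotient.eq I).mpr hw, ← smul_eq_mul, Submodule.Quotient.mk_smul]
  exact Submodule.smul_mem_smul (Ideal.pow_mem_pow hym n) trivial

/-- If the maximal ideal of `R ⧸ I` is generated by the nilpotent class of `y`, then the
annihilator of `y` in `R ⧸ I` is a copy of the residue field. -/
theorem existsSES_residueField_quotient (hm : maximalIdeal R = Ideal.span {y} ⊔ I)
    (hy : ∃ n, y ^ n ∈ I) :
    ExistsSES R (ResidueField R) (R ⧸ I) (LinearMap.range (LinearMap.lsmul R (R ⧸ I) y)) := by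
  classical
  have hI : I ≤ maximalIdeal R := hm ▸ le_sup_right
  obtain ⟨n, hn, hn'⟩ : ∃ n, y ^ n ∉ I ∧ y ^ (n + 1) ∈ I := by
    obtain ⟨n, hn⟩ : ∃ n, Nat.find hy = n + 1 := Nat.exists_eq_succ_of_ne_zero fun h => by
      have h1 := Nat.find_spec hy
      rw [h, pow_zero] at h1
      exact (Ideal.ne_top_iff_one _).mp (maximalIdeal.isMaximal R).ne_top (hI h1)
    exact ⟨n, Nat.find_min hy (by lia), hn ▸ Nat.find_spec hy⟩
  let i : ResidueField R →ₗ[R] R ⧸ I := Submodule.liftQ (maximalIdeal R)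
    (LinearMap.toSpanSingleton R (R ⧸ I) (Submodule.Quotient.mk (y ^ n))) (fun x hx => by
      rw [LinearMap.mem_ker, LinearMap.toSpanSingleton_apply, ← Submodule.Quotient.mk_smul,
        Submodule.Quotient.mk_eq_zero, smul_eq_mul]
      rw [hm] at hx
      obtain ⟨a, ha, b, hb, rfl⟩ := Submodule.mem_sup.mp hx
      obtain ⟨s, rfl⟩ := Ideal.mem_span_singleton'.mp ha
      have h : (s * y + b) * y ^ n = s * y ^ (n + 1) + y ^ n * b := by ring
      rw [h]
      exact add_mem (I.mul_mem_left _ hn') (I.mul_mem_left _ hb))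
  have hi : ∀ r : R, i (residue R r) = Submodule.Quotient.mk (r * y ^ n) := fun r => rfl
  refine ⟨i, (LinearMap.lsmul R (R ⧸ I) y).rangeRestrict, ?_, LinearMap.surjective_rangeRestrict _,
    ?_⟩
  · refine (injective_iff_map_eq_zero i).mpr fun c hc => ?_
    obtain ⟨r, rfl⟩ := residue_surjective c
    rw [hi, Submodule.Quotient.mk_eq_zero] at hc
    by_contra hr
    obtain ⟨v, rfl⟩ := notMem_maximalIdeal.mp (mt (residue_eq_zero_iff r).mpr hr)
    exact hn ((Ideal.unit_mul_mem_iff_mem I v.isUnit).mp hc)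
  · rw [LinearMap.ker_rangeRestrict]
    ext c
    constructor
    · rintro ⟨c, rfl⟩
      obtain ⟨r, rfl⟩ := residue_surjective c
      rw [hi, LinearMap.mem_ker, LinearMap.lsmul_apply, ← Submodule.Quotient.mk_smul,
        Submodule.Quotient.mk_eq_zero]
      have h : y • (r * y ^ n) = r * y ^ (n + 1) := by rw [smul_eq_mul]; ring
      rw [h]
      exact I.mul_mem_left _ hn'
    · obtain ⟨z, rfl⟩ := Submodule.Quotient.mk_surjective I c
      rw [LinearMap.mem_ker, LinearMap.lsmul_apply, ← Submodule.Quotient.mk_smul,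
        Submodule.Quotient.mk_eq_zero, smul_eq_mul]
      intro hz
      obtain ⟨w, hw⟩ := exists_sub_pow_mul_mem_of_mul_mem hm hz hn
      refine ⟨residue R w, ?_⟩
      rw [hi, (Submodule.Quotient.eq I).mpr hw, mul_comm]

theorem existsSES_quotient_residueField (hm : maximalIdeal R = Ideal.span {y} ⊔ I) :
    ExistsSES R (LinearMap.range (LinearMap.lsmul R (R ⧸ I) y)) (R ⧸ I) (ResidueField R) := by
  have hI : I ≤ maximalIdeal R := hm ▸ le_sup_right
  let p : (R ⧸ I) →ₗ[R] ResidueField R := Submodule.factor hI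
  have hp : ∀ r : R, p (Submodule.Quotient.mk r) = residue R r := fun r => rfl
  refine ⟨Submodule.subtype _, p, Subtype.val_injective, Submodule.factor_surjective hI, ?_⟩
  rw [Submodule.range_subtype]
  ext c
  obtain ⟨r, rfl⟩ := Submodule.Quotient.mk_surjective I c
  rw [LinearMap.mem_ker, hp, residue_eq_zero_iff, hm]
  constructor
  · rintro ⟨z, hz⟩
    obtain ⟨s, rfl⟩ := Submodule.Quotient.mk_surjective I z
    rw [LinearMap.lsmul_apply, ← Submodule.Quotient.mk_smul, eq_comm, Submodule.Quotient.eq] at hz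
    rw [← sub_add_cancel r (y • s)]
    exact add_mem (Submodule.mem_sup_right hz)
      (Submodule.mem_sup_left (Ideal.mem_span_singleton'.mpr ⟨s, mul_comm s y⟩))
  · intro hr
    obtain ⟨a, ha, b, hb, rfl⟩ := Submodule.mem_sup.mp hr
    obtain ⟨s, rfl⟩ := Ideal.mem_span_singleton'.mp ha
    refine ⟨Submodule.Quotient.mk s, ?_⟩
    rw [LinearMap.lsmul_apply, ← Submodule.Quotient.mk_smul, eq_comm, Submodule.Quotient.eq,
      smul_eq_mul, mul_comm y s, add_sub_cancel_left]
    exact hb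

end Socle

section Assembly

variable {R : Type u} [CommRing R]

theorem ExistsSES.finite_right {A B C : Type u} [AddCommGroup A] [Module R A] [AddCommGroup B]
    [Module R B] [AddCommGroup C] [Module R C] [Module.Finite R B] (h : ExistsSES R A B C) :
    Module.Finite R C := by
  obtain ⟨_, p, _, hp, _⟩ := h
  exact .of_surjective p hp

theorem MinFreeRes.exists_existsSES_syz [IsNoetherianRing R] {𝔪 : Ideal R} {M B C : Type u}
    [AddCommGroup M] [Module R M] [AddCommGroup B] [Module R B] [AddCommGroup C] [Module R C]
    [Module.Finite R B] (F : MinFreeRes R 𝔪 M) (h₁ : ExistsSES R M B C) (h₂ : ExistsSES R C B M)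
    (j n : ℕ) (hB : HasProjectiveDimensionLT (ModuleCat.of R B) (j + n + 1)) :
    ∃ C' B₁ B₂ : ModuleCat.{u} R, Module.Finite R B₁ ∧ Module.Finite R B₂ ∧
      HasProjectiveDimensionLT B₁ (n + 1) ∧ HasProjectiveDimensionLT B₂ (n + 1) ∧
      ExistsSES R (F.Syz j) B₁ C' ∧ ExistsSES R C' B₂ (F.Syz j) := by
  induction j generalizing n with
  | zero =>
    rw [zero_add] at hB
    exact ⟨.of R C, .of R B, .of R B, ‹_›, ‹_›, hB, hB, h₁, h₂⟩
  | succ j ih =>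
    obtain ⟨C', B₁, B₂, hf₁, hf₂, hd₁, hd₂, hs₁, hs₂⟩ := ih (n + 1) (by
      rwa [show j + (n + 1) + 1 = j + 1 + n + 1 by lia])
    have := hs₁.finite_right
    obtain ⟨q, f, hf⟩ := Module.Finite.exists_fin' R C'
    have hK : ExistsSES R (LinearMap.ker f) (Fin q → R) C' :=
      ⟨Submodule.subtype _, f, Subtype.val_injective, hf, Submodule.range_subtype _⟩
    obtain ⟨B₁', hf₁', hd₁', hs₁'⟩ := hs₁.horseshoe (hB := hd₁) (F.existsSES j) hK
    obtain ⟨B₂', hf₂', hd₂', hs₂'⟩ := hs₂.horseshoe (hB := hd₂) hK (F.existsSES j)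
    exact ⟨.of R (LinearMap.ker f), B₁', B₂', hf₁', hf₂', hd₁', hd₂', hs₁', hs₂'⟩

theorem LinearMap.range_le_ideal_smul_top {𝔪 : Ideal R} {X P : Type u} [AddCommGroup X]
    [Module R X] [AddCommGroup P] [Module R P] [Module.Free R P] [Module.Finite R P]
    (h : ∀ (f : X →ₗ[R] R) (x : X), f x ∈ 𝔪) (g : X →ₗ[R] P) :
    LinearMap.range g ≤ 𝔪 • (⊤ : Submodule R P) := by
  rintro _ ⟨x, rfl⟩
  let b := Module.Free.chooseBasis R P
  rw [← b.sum_repr (g x)]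
  exact sum_mem fun i _ => Submodule.smul_mem_smul (h (b.coord i ∘ₗ g) x) trivial

theorem ModuleCat.free_of_hasProjectiveDimensionLT_one [IsLocalRing R] (P : ModuleCat.{u} R)
    [Module.Finite R P] [h : HasProjectiveDimensionLT P 1] : Module.Free R P := by
  have := (projective_iff_hasProjectiveDimensionLT_one).mpr h
  have : Module.Projective R P := (IsProjective.iff_projective P).mpr this
  exact Module.free_of_flat_of_isLocalRing

end Assembly

end

/-- if `R` is a singular hypersurface (edim R − depth R ≤ 1 and `R`
is not regular) of depth `t`, then `Ω^t(k) ≅ Ω^{t+2}(k)`. -/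
theorem stmt15 (R : Type u) [CommRing R] [IsNoetherianRing R] [IsLocalRing R]
    (t e : ℕ) (ht : HasDepth R (IsLocalRing.maximalIdeal R) R t)
    (he : HasMinGens R (IsLocalRing.maximalIdeal R) e)
    (hhyp : e ≤ t + 1)
    (hsing : ¬ IsRegularWrt R (IsLocalRing.maximalIdeal R)) :
    ∀ F : MinFreeRes R (IsLocalRing.maximalIdeal R) (IsLocalRing.ResidueField R),
      Nonempty (F.Syz t ≃ₗ[R] F.Syz (t + 2)) := by
  intro F
  obtain ⟨⟨s, hs, hspan⟩, -⟩ := he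
  obtain ⟨I, s', hI, hs', hcard, -⟩ := exists_isMinimalRegularIdeal ht hspan le_rfl
  have hmI : ¬ IsLocalRing.maximalIdeal R ≤ I := fun h => hsing (by
    obtain rfl := le_antisymm h hI.le_maximalIdeal
    exact hI.isRegularWrt)
  obtain ⟨y, rfl⟩ : ∃ y, s' = {y} := by
    refine Finset.card_eq_one.mp (le_antisymm (by lia) (Finset.card_pos.mpr ?_))
    rw [Finset.nonempty_iff_ne_empty]
    rintro rfl
    exact hmI (by simpa using hs'.le)
  rw [Finset.coe_singleton] at hs'
  have hy : y ∈ IsLocalRing.maximalIdeal R :=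
    hs' ▸ Submodule.mem_sup_left (Ideal.mem_span_singleton_self y)
  obtain ⟨C, B₁, B₂, hf₁, hf₂, hd₁, hd₂, ⟨i₁, p₁, hi₁, hp₁, h₁⟩, i₂, p₂, hi₂, hp₂, h₂⟩ :=
    F.exists_existsSES_syz (existsSES_residueField_quotient hs'
      (exists_pow_mem_of_not_isSMulRegular hs' (hI.not_isSMulRegular ht hy)))
      (existsSES_quotient_residueField hs') t 0 hI.hasProjectiveDimensionLT
  have := ModuleCat.free_of_hasProjectiveDimensionLT_one B₁
  have := ModuleCat.free_of_hasProjectiveDimensionLT_one B₂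
  have hext := F.extVanishesOnResidueField_syz t 0
    (hI.extVanishesOnResidueField (extVanishesOnResidueField_zero hmI))
  let S : SecondSyzygy R (F.Syz t) B₁ B₂ (F.Syz t) :=
    { ι := i₁
      d := i₂ ∘ₗ p₁
      π := p₂
      inj := hi₁
      surj := hp₂
      range_ι := by rw [LinearMap.ker_comp_of_ker_eq_bot _ (LinearMap.ker_eq_bot.mpr hi₂), h₁]
      range_d := by rw [LinearMap.range_comp_of_range_eq_top _ (LinearMap.range_eq_top.mpr hp₁), h₂] }
  exact S.nonempty_linearEquiv (F.secondSyzygy t)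
    (LinearMap.range_le_ideal_smul_top hext.apply_mem_maximalIdeal i₁) (F.range_incl_le (t + 1))
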